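/- arXiv:1907.02837 — 2 statements merged into one kernel-verified Lean document; each statement's English description precedes it below -/
import Mathlib

section
/- Let Ω ⊂ ℝ^N (N ≥ 2) be a smooth bounded domain, assume (S1), (P1), (μ1), let q ∈ C₊(ℝ^N×ℝ^N) satisfy 2/q(x,y) + μ(x,y)/N = 2, and let f satisfy (F1) and (F2). If (u_m) ⊂ X₀ is a Palais–Smale sequence for J, i.e., J(u_m) → c for some c ∈ ℝ and sup{|⟨J′(u_m),w⟩| : w ∈ X₀, ‖w‖_{X₀} ≤ 1} → 0 as m → ∞, then the sequence (u_m) is bounded in X₀: sup_m ‖u_m‖_{X₀} < ∞. -/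
open MeasureTheory Set Filter ENNReal

noncomputable section

namespace VarOrderChoquard

variable {N : ℕ}

/-- `ℝ^N` with the Euclidean structure. -/
abbrev RN (N : ℕ) := EuclideanSpace ℝ (Fin N)

/-- `Φ⁻` : infimum of a two-variable real function over `ℝ^N × ℝ^N`. -/
def inf2 (f : RN N → RN N → ℝ) : ℝ := sInf {t | ∃ x y, f x y = t}

/-- `Φ⁺` : supremum of a two-variable real function over `ℝ^N × ℝ^N`. -/
def sup2 (f : RN N → RN N → ℝ) : ℝ := sSup {t | ∃ x y, f x y = t}

/-- `Φ⁻` over a subset `D ⊆ ℝ^N`. -/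
def infOn (D : Set (RN N)) (g : RN N → ℝ) : ℝ := sInf (g '' D)

/-- `Φ⁺` over a subset `D ⊆ ℝ^N`. -/
def supOn (D : Set (RN N)) (g : RN N → ℝ) : ℝ := sSup (g '' D)

/-- `C₊(ℝ^N × ℝ^N)` : continuous with `1 < Φ⁻ ≤ Φ⁺ < ∞`. -/
def CPlus2 (f : RN N → RN N → ℝ) : Prop :=
  Continuous (fun z : RN N × RN N => f z.1 z.2) ∧ 1 < inf2 f ∧
    BddAbove {t | ∃ x y, f x y = t}

/-- `C₊(D)` for `D ⊆ ℝ^N`. -/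
def CPlusOn (D : Set (RN N)) (g : RN N → ℝ) : Prop :=
  ContinuousOn g D ∧ 1 < infOn D g ∧ BddAbove (g '' D)

/-- Condition (S1). -/
def S1 (s : RN N → RN N → ℝ) : Prop :=
  Continuous (fun z : RN N × RN N => s z.1 z.2) ∧ (∀ x y, s x y = s y x) ∧
    BddAbove {t | ∃ x y, s x y = t} ∧ 0 < inf2 s ∧ sup2 s < 1

/-- Condition (P1). -/
def P1 (s p : RN N → RN N → ℝ) : Prop :=
  CPlus2 p ∧ (∀ x y, p x y = p y x) ∧ sup2 s * sup2 p < N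

/-- Condition (μ1). -/
def Mu1 (μ : RN N → RN N → ℝ) : Prop :=
  (∀ x y, μ x y = μ y x) ∧ BddAbove {t | ∃ x y, μ x y = t} ∧
    0 < inf2 μ ∧ sup2 μ < N

/-- The critical exponent `p_s*(x) = N p(x,x) / (N - s(x,x) p(x,x))`. -/
def pstar (s p : RN N → RN N → ℝ) (x : RN N) : ℝ :=
  N * p x x / (N - s x x * p x x)

/-- The class `𝓜` : `p(x,x) ≤ r(x)q⁻ ≤ r(x)q⁺ < p_s*(x)` for all `x`. -/
def MemM (s p q : RN N → RN N → ℝ) (r : RN N → ℝ) : Prop :=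
  ∀ x, p x x ≤ r x * inf2 q ∧ r x * inf2 q ≤ r x * sup2 q ∧
    r x * sup2 q < pstar s p x

/-- Variable-exponent modular `∫_U |u/l|^{γ(x)} dx`. -/
def lmodular (U : Set (RN N)) (γ : RN N → ℝ) (u : RN N → ℝ) (l : ℝ) : ℝ≥0∞ :=
  ∫⁻ x in U, ENNReal.ofReal (|u x| / l) ^ γ x

/-- Membership in the variable-exponent Lebesgue space `L^{γ(x)}(U)`. -/
def MemVarLp (U : Set (RN N)) (γ : RN N → ℝ) (u : RN N → ℝ) : Prop :=
  Measurable u ∧ ∃ l, 0 < l ∧ lmodular U γ u l < ⊤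

/-- Luxemburg norm on `L^{γ(x)}(U)`. -/
def luxNorm (U : Set (RN N)) (γ : RN N → ℝ) (u : RN N → ℝ) : ℝ :=
  sInf {l | 0 < l ∧ lmodular U γ u l ≤ 1}

/-- Membership in the classical Lebesgue space `L^t(U)` (constant exponent `t`). -/
def MemCLp (U : Set (RN N)) (t : ℝ) (g : RN N → ℝ) : Prop :=
  Measurable g ∧ (∫⁻ x in U, ENNReal.ofReal |g x| ^ t) < ⊤

/-- The classical `L^t(U)`-norm. -/
def cLpNorm (U : Set (RN N)) (t : ℝ) (g : RN N → ℝ) : ℝ :=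
  (∫⁻ x in U, ENNReal.ofReal |g x| ^ t).toReal ^ (1 / t)

/-- Gagliardo-type modular
`∫_A (|u(x)-u(y)|/l)^{p(x,y)} / |x-y|^{N+s(x,y)p(x,y)} dx dy`. -/
def gmodular (A : Set (RN N × RN N)) (s p : RN N → RN N → ℝ) (u : RN N → ℝ)
    (l : ℝ) : ℝ≥0∞ :=
  ∫⁻ z in A, ENNReal.ofReal (|u z.1 - u z.2| / l) ^ p z.1 z.2 /
    ENNReal.ofReal (dist z.1 z.2) ^ ((N : ℝ) + s z.1 z.2 * p z.1 z.2)

/-- Membership in `W^{s(x,y),β(x),p(x,y)}(U)`. -/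
def MemW (U : Set (RN N)) (s p : RN N → RN N → ℝ) (β : RN N → ℝ)
    (u : RN N → ℝ) : Prop :=
  MemVarLp U β u ∧ ∃ l, 0 < l ∧ gmodular (U ×ˢ U) s p u l < ⊤

/-- The Gagliardo seminorm `[u]_U^{s,p}`. -/
def wSeminorm (U : Set (RN N)) (s p : RN N → RN N → ℝ) (u : RN N → ℝ) : ℝ :=
  sInf {l | 0 < l ∧ gmodular (U ×ˢ U) s p u l < 1}

/-- The norm on `W`. -/
def wNorm (U : Set (RN N)) (s p : RN N → RN N → ℝ) (β : RN N → ℝ)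
    (u : RN N → ℝ) : ℝ :=
  luxNorm U β u + wSeminorm U s p u

/-- `Q = (ℝ^N × ℝ^N) \ (Ωᶜ × Ωᶜ)`. -/
def Qset (Ω : Set (RN N)) : Set (RN N × RN N) := univ \ (Ωᶜ ×ˢ Ωᶜ)

/-- Membership in `X₀`. -/
def MemX0 (Ω : Set (RN N)) (s p : RN N → RN N → ℝ) (β : RN N → ℝ)
    (u : RN N → ℝ) : Prop :=
  Measurable u ∧ MemVarLp Ω β u ∧ (∃ l, 0 < l ∧ gmodular (Qset Ω) s p u l < ⊤) ∧
    (∀ᵐ x, x ∉ Ω → u x = 0)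

/-- The `X₀`-norm. -/
def x0Norm (s p : RN N → RN N → ℝ) (u : RN N → ℝ) : ℝ :=
  sInf {l | 0 < l ∧ gmodular univ s p u l < 1}

/-- The modular `ρ_{X₀}`. -/
def rhoX0 (s p : RN N → RN N → ℝ) (u : RN N → ℝ) : ℝ≥0∞ :=
  gmodular univ s p u 1

/-- Carathéodory function. -/
def Caratheodory (f : RN N → ℝ → ℝ) : Prop :=
  (∀ t, Measurable fun x => f x t) ∧ ∀ x, Continuous fun t => f x t

/-- `F(x,t) = ∫₀ᵗ f(x,τ) dτ`. -/
def Fant (f : RN N → ℝ → ℝ) (x : RN N) (t : ℝ) : ℝ := ∫ τ in (0:ℝ)..t, f x τ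

/-- Growth condition (F1) (with data `M` and `r`). -/
def F1 (Ω : Set (RN N)) (f : RN N → ℝ → ℝ) (M : ℝ) (r : RN N → ℝ) : Prop :=
  0 < M ∧ ∀ x ∈ Ω, ∀ t : ℝ, |f x t| ≤ M * |t| ^ (r x - 1)

/-- Ambrosetti–Rabinowitz type condition (F2) (with data `Θ`). -/
def F2 (Ω : Set (RN N)) (f : RN N → ℝ → ℝ) (Θ : ℝ) : Prop :=
  ∀ᵐ x, x ∈ Ω → ∀ t : ℝ, t ≠ 0 →
    0 < Θ * Fant f x t ∧ Θ * Fant f x t ≤ 2 * (t * f x t)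

/-- The left-hand side pairing
`∫∫ |u(x)-u(y)|^{p-2}(u(x)-u(y))(w(x)-w(y)) / |x-y|^{N+sp} dx dy`. -/
def energyLHS (s p : RN N → RN N → ℝ) (u w : RN N → ℝ) : ℝ :=
  ∫ z : RN N × RN N,
    |u z.1 - u z.2| ^ (p z.1 z.2 - 2) * (u z.1 - u z.2) * (w z.1 - w z.2) /
      dist z.1 z.2 ^ ((N : ℝ) + s z.1 z.2 * p z.1 z.2)

/-- The Choquard right-hand side `∫_Ω ∫_Ω F(x,u(x)) f(y,u(y)) w(y) / |x-y|^μ`. -/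
def choquardRHS (Ω : Set (RN N)) (μ : RN N → RN N → ℝ) (f : RN N → ℝ → ℝ)
    (u w : RN N → ℝ) : ℝ :=
  ∫ x in Ω, ∫ y in Ω, Fant f x (u x) * f y (u y) * w y / dist x y ^ μ x y

/-- The energy functional `J`. -/
def Jfun (Ω : Set (RN N)) (s p μ : RN N → RN N → ℝ) (f : RN N → ℝ → ℝ)
    (u : RN N → ℝ) : ℝ :=
  (∫ z : RN N × RN N,
    |u z.1 - u z.2| ^ p z.1 z.2 /
      (p z.1 z.2 * dist z.1 z.2 ^ ((N : ℝ) + s z.1 z.2 * p z.1 z.2)))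
  - (1/2) * ∫ x in Ω, ∫ y in Ω,
      Fant f x (u x) * Fant f y (u y) / dist x y ^ μ x y

/-- `⟨J'(u), w⟩`. -/
def Jderiv (Ω : Set (RN N)) (s p μ : RN N → RN N → ℝ) (f : RN N → ℝ → ℝ)
    (u w : RN N → ℝ) : ℝ :=
  energyLHS s p u w - choquardRHS Ω μ f u w

/-- The perturbed functional `J_λ`. -/
def Jlam (Ω : Set (RN N)) (s p μ : RN N → RN N → ℝ) (f : RN N → ℝ → ℝ)
    (α : RN N → ℝ) (lam : ℝ) (u : RN N → ℝ) : ℝ :=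
  Jfun Ω s p μ f u - lam * ∫ x in Ω, |u x| ^ α x / α x


lemma inf2_le {g : RN N → RN N → ℝ} (h : 0 < inf2 g) (x y : RN N) : inf2 g ≤ g x y := by
  refine csInf_le ?_ ⟨x, y, rfl⟩
  by_contra hb
  have h0 := Real.sInf_of_not_bddBelow hb
  unfold inf2 at h
  linarith

lemma le_sup2 {g : RN N → RN N → ℝ} (h : BddAbove {t | ∃ x y, g x y = t}) (x y : RN N) :
    g x y ≤ sup2 g :=
  le_csSup h ⟨x, y, rfl⟩

lemma ofReal_rpow_div_ofReal_rpow {a d P e : ℝ} (ha : 0 ≤ a) (hd : 0 ≤ d)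
    (had : d = 0 → a = 0) (hP : 0 < P) :
    ENNReal.ofReal a ^ P / ENNReal.ofReal d ^ e = ENNReal.ofReal (a ^ P / d ^ e) := by
  rcases hd.eq_or_lt with h | h
  · rw [had h.symm]
    simp [hP, Real.zero_rpow hP.ne']
  · rw [ENNReal.ofReal_rpow_of_nonneg ha hP.le, ENNReal.ofReal_rpow_of_pos h,
      ENNReal.ofReal_div_of_pos (Real.rpow_pos_of_pos h e)]

section Modular

variable {s p : RN N → RN N → ℝ} {u : RN N → ℝ}

lemma gmodular_div (A : Set (RN N × RN N)) {l l' : ℝ} (hl : 0 < l) :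
    gmodular A s p (fun x => u x / l) l' = gmodular A s p u (l * l') := by
  unfold gmodular
  simp_rw [← sub_div, abs_div, abs_of_pos hl, div_div]

lemma lmodular_div (U : Set (RN N)) (γ : RN N → ℝ) {l l' : ℝ} (hl : 0 < l) :
    lmodular U γ (fun x => u x / l) l' = lmodular U γ u (l * l') := by
  unfold lmodular
  simp_rw [abs_div, abs_of_pos hl, div_div]

lemma MemX0.div {Ω : Set (RN N)} {β : RN N → ℝ} (h : MemX0 Ω s p β u) {l : ℝ} (hl : 0 < l) :
    MemX0 Ω s p β (fun x => u x / l) := by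
  obtain ⟨hu, ⟨-, l₁, hl₁, h₁⟩, ⟨l₂, hl₂, h₂⟩, h0⟩ := h
  refine ⟨hu.div_const l, ⟨hu.div_const l, l₁ / l, by positivity, ?_⟩,
    ⟨l₂ / l, by positivity, ?_⟩, ?_⟩
  · rwa [lmodular_div _ _ hl, mul_div_cancel₀ _ hl.ne']
  · rwa [gmodular_div _ hl, mul_div_cancel₀ _ hl.ne']
  · filter_upwards [h0] with x hx hxΩ
    simp [hx hxΩ]

lemma ofReal_rpow_scale {t l P : ℝ} (hl : 0 < l) (hP : 0 ≤ P) :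
    ENNReal.ofReal (t / 1) ^ P = ENNReal.ofReal (l ^ P) * ENNReal.ofReal (t / l) ^ P := by
  rw [← ENNReal.ofReal_rpow_of_pos hl, ← ENNReal.mul_rpow_of_nonneg _ _ hP,
    ← ENNReal.ofReal_mul hl.le, mul_div_cancel₀ _ hl.ne', div_one]

lemma gmodular_one_le (A : Set (RN N × RN N)) {l P : ℝ} (hl : 0 < l)
    (hp0 : ∀ x y, 0 ≤ p x y) (hpP : ∀ x y, p x y ≤ P) :
    gmodular A s p u 1 ≤ ENNReal.ofReal (max 1 l ^ P) * gmodular A s p u l := by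
  unfold gmodular
  rw [← lintegral_const_mul' _ _ ENNReal.ofReal_ne_top]
  refine lintegral_mono fun z => ?_
  rw [ofReal_rpow_scale hl (hp0 _ _), mul_div_assoc]
  gcongr
  calc l ^ p z.1 z.2 ≤ max 1 l ^ p z.1 z.2 :=
        Real.rpow_le_rpow hl.le (le_max_right _ _) (hp0 _ _)
    _ ≤ max 1 l ^ P := Real.rpow_le_rpow_of_exponent_le (le_max_left _ _) (hpP _ _)

lemma le_gmodular_one (A : Set (RN N × RN N)) {l P : ℝ} (hl : 1 ≤ l)
    (hp0 : ∀ x y, 0 ≤ p x y) (hPp : ∀ x y, P ≤ p x y) :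
    ENNReal.ofReal (l ^ P) * gmodular A s p u l ≤ gmodular A s p u 1 := by
  unfold gmodular
  rw [← lintegral_const_mul' _ _ ENNReal.ofReal_ne_top]
  refine lintegral_mono fun z => ?_
  rw [ofReal_rpow_scale (by linarith : 0 < l) (hp0 _ _), mul_div_assoc]
  gcongr
  exact hPp _ _

lemma one_le_gmodular_of_lt_x0Norm {l : ℝ} (hl : 0 < l) (h : l < x0Norm s p u) :
    1 ≤ gmodular univ s p u l := by
  by_contra! hlt
  exact absurd (csInf_le ⟨0, fun t ht => ht.1.le⟩ (show l ∈ {l | 0 < l ∧ gmodular univ s p u l < 1}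
    from ⟨hl, hlt⟩)) (not_le.2 h)

lemma exists_gmodular_lt_one {L : ℝ} (h0 : 0 < x0Norm s p u) (h : x0Norm s p u < L) :
    ∃ l, 0 < l ∧ l < L ∧ gmodular univ s p u l < 1 := by
  have hne : {l | 0 < l ∧ gmodular univ s p u l < 1}.Nonempty := by
    by_contra hne
    rw [Set.not_nonempty_iff_eq_empty] at hne
    simp [x0Norm, hne] at h0
  obtain ⟨l, hl, hlL⟩ := exists_lt_of_csInf_lt hne h
  exact ⟨l, hl.1, hlL, hl.2⟩

lemma x0Norm_le_one (h : gmodular univ s p u 1 < 1) : x0Norm s p u ≤ 1 :=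
  csInf_le ⟨0, fun _ ht => ht.1.le⟩ ⟨one_pos, h⟩

lemma gmodular_univ_le {Ω : Set (RN N)} (hp0 : ∀ x y, 0 < p x y) (l : ℝ)
    (h0 : ∀ᵐ x, x ∉ Ω → u x = 0) (hΩ : MeasurableSet Ω) :
    gmodular univ s p u l ≤ gmodular (Qset Ω) s p u l := by
  have hcover : (univ : Set (RN N × RN N)) = Qset Ω ∪ Ωᶜ ×ˢ Ωᶜ := by
    simp [Qset]
  have hz : gmodular (Ωᶜ ×ˢ Ωᶜ) s p u l = 0 := by
    unfold gmodular
    rw [← lintegral_zero]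
    refine setLIntegral_congr_fun_ae (hΩ.compl.prod hΩ.compl) ?_
    have h1 : ∀ᵐ z : RN N × RN N, z.1 ∉ Ω → u z.1 = 0 :=
      Measure.quasiMeasurePreserving_fst.ae h0
    have h2 : ∀ᵐ z : RN N × RN N, z.2 ∉ Ω → u z.2 = 0 :=
      Measure.quasiMeasurePreserving_snd.ae h0
    filter_upwards [h1, h2] with z hz1 hz2 hz
    simp [hz1 hz.1, hz2 hz.2, hp0]
  calc gmodular univ s p u l ≤ gmodular (Qset Ω) s p u l + gmodular (Ωᶜ ×ˢ Ωᶜ) s p u l := by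
        unfold gmodular
        rw [hcover]
        exact lintegral_union_le _ _ _
    _ = gmodular (Qset Ω) s p u l := by rw [hz, add_zero]

/-- The integrand of the Gagliardo modular, as a real function. -/
def gagliardoDensity (s p : RN N → RN N → ℝ) (u : RN N → ℝ) (z : RN N × RN N) : ℝ :=
  |u z.1 - u z.2| ^ p z.1 z.2 / dist z.1 z.2 ^ ((N : ℝ) + s z.1 z.2 * p z.1 z.2)

lemma gagliardoDensity_nonneg (z : RN N × RN N) : 0 ≤ gagliardoDensity s p u z := by
  unfold gagliardoDensity
  positivity

lemma measurable_gagliardoDensity (hs : Continuous fun z : RN N × RN N => s z.1 z.2)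
    (hp : Continuous fun z : RN N × RN N => p z.1 z.2) (hu : Measurable u) :
    Measurable (gagliardoDensity s p u) := by
  have hs' := hs.measurable
  have hp' := hp.measurable
  have h1 : Measurable fun z : RN N × RN N => |u z.1 - u z.2| := by
    simp_rw [← Real.norm_eq_abs]
    exact ((hu.comp measurable_fst).sub (hu.comp measurable_snd)).norm
  exact (h1.pow hp').div (measurable_dist.pow (measurable_const.add (hs'.mul hp')))

lemma gmodular_one_eq (hp0 : ∀ x y, 0 < p x y) :
    gmodular univ s p u 1 = ∫⁻ z, ENNReal.ofReal (gagliardoDensity s p u z) := by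
  unfold gmodular gagliardoDensity
  rw [Measure.restrict_univ]
  refine lintegral_congr fun z => ?_
  rw [div_one]
  refine ofReal_rpow_div_ofReal_rpow (abs_nonneg _) dist_nonneg (fun h => ?_) (hp0 _ _)
  rw [dist_eq_zero] at h
  simp [h]

lemma integrable_gagliardoDensity {Ω : Set (RN N)} {β : RN N → ℝ} {P : ℝ} (hΩ : MeasurableSet Ω)
    (hs : Continuous fun z : RN N × RN N => s z.1 z.2)
    (hp : Continuous fun z : RN N × RN N => p z.1 z.2)
    (hp0 : ∀ x y, 0 < p x y) (hpP : ∀ x y, p x y ≤ P) (hu : MemX0 Ω s p β u) :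
    Integrable (gagliardoDensity s p u) := by
  obtain ⟨hum, -, ⟨l, hl, hfin⟩, h0⟩ := hu
  refine ⟨(measurable_gagliardoDensity hs hp hum).aestronglyMeasurable, ?_⟩
  rw [hasFiniteIntegral_iff_ofReal (Eventually.of_forall gagliardoDensity_nonneg),
    ← gmodular_one_eq hp0]
  calc gmodular univ s p u 1
      ≤ ENNReal.ofReal (max 1 l ^ P) * gmodular univ s p u l :=
        gmodular_one_le _ hl (fun x y => (hp0 x y).le) hpP
    _ < ⊤ := ENNReal.mul_lt_top ENNReal.ofReal_lt_top
        ((gmodular_univ_le hp0 l h0 hΩ).trans_lt hfin)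

lemma energyLHS_self (hp0 : ∀ x y, 0 < p x y) :
    energyLHS s p u u = ∫ z, gagliardoDensity s p u z := by
  unfold energyLHS gagliardoDensity
  refine integral_congr_ae (Eventually.of_forall fun z => ?_)
  dsimp only
  congr 1
  rw [mul_assoc, ← abs_mul_abs_self (u z.1 - u z.2)]
  rcases (abs_nonneg (u z.1 - u z.2)).eq_or_lt with h | h
  · rw [← h, Real.zero_rpow (hp0 _ _).ne']
    simp
  · rw [← pow_two, ← Real.rpow_natCast, ← Real.rpow_add h]
    norm_num

lemma energyLHS_div (v : RN N → ℝ) (l : ℝ) :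
    energyLHS s p u (fun x => v x / l) = energyLHS s p u v / l := by
  unfold energyLHS
  rw [← integral_div]
  refine integral_congr_ae (Eventually.of_forall fun z => ?_)
  dsimp only
  ring

lemma rpow_le_integral_gagliardoDensity {l P : ℝ} (hp0 : ∀ x y, 0 < p x y)
    (hPp : ∀ x y, P ≤ p x y) (hint : Integrable (gagliardoDensity s p u)) (hl : 1 ≤ l)
    (h : l < x0Norm s p u) : l ^ P ≤ ∫ z, gagliardoDensity s p u z := by
  have h1 := one_le_gmodular_of_lt_x0Norm (by linarith) h
  have h2 := le_gmodular_one (s := s) (u := u) univ hl (fun x y => (hp0 x y).le) hPp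
  rw [gmodular_one_eq hp0, ← ofReal_integral_eq_lintegral_ofReal hint
    (Eventually.of_forall gagliardoDensity_nonneg)] at h2
  rw [← ENNReal.ofReal_le_ofReal_iff (integral_nonneg gagliardoDensity_nonneg)]
  exact (le_mul_of_one_le_right' h1).trans h2

end Modular

lemma choquardRHS_div (Ω : Set (RN N)) (μ : RN N → RN N → ℝ) (f : RN N → ℝ → ℝ)
    (u v : RN N → ℝ) (l : ℝ) :
    choquardRHS Ω μ f u (fun x => v x / l) = choquardRHS Ω μ f u v / l := by
  unfold choquardRHS
  rw [← integral_div]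
  refine integral_congr_ae (Eventually.of_forall fun x => ?_)
  dsimp only
  rw [← integral_div]
  refine integral_congr_ae (Eventually.of_forall fun y => ?_)
  dsimp only
  ring

lemma inv_rpow_le_one_add_rpow_neg {d m a : ℝ} (hd : 0 ≤ d) (hm : 0 < m) (hma : m ≤ a) :
    (d ^ m)⁻¹ ≤ 1 + d ^ (-a) := by
  rcases hd.eq_or_lt with rfl | hd
  · rw [Real.zero_rpow hm.ne', _root_.inv_zero]
    positivity
  · rw [← Real.rpow_neg hd.le]
    rcases le_total 1 d with h | h
    · have := Real.rpow_le_one_of_one_le_of_nonpos h (neg_nonpos.2 hm.le)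
      have := Real.rpow_nonneg hd.le (-a)
      linarith
    · have := Real.rpow_le_rpow_of_exponent_ge hd h (neg_le_neg hma)
      linarith

section Riesz

variable {Ω : Set (RN N)} {μ : RN N → RN N → ℝ} {a : ℝ}

/-- On a bounded set, an integrable density has an a.e. convergent Riesz-type potential. -/
lemma ae_integrableOn_div_dist_rpow (hN : 1 ≤ N) (hΩ : MeasurableSet Ω)
    (hΩb : Bornology.IsBounded Ω) (hμc : Continuous fun z : RN N × RN N => μ z.1 z.2)
    (hμ0 : ∀ x y, 0 < μ x y) (hμa : ∀ x y, μ x y ≤ a) (haN : a < N) {φ : RN N → ℝ}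
    (hφ : IntegrableOn φ Ω) :
    ∀ᵐ x, x ∈ Ω → IntegrableOn (fun y => φ y / dist x y ^ μ x y) Ω := by
  obtain ⟨R, hR⟩ := Metric.isBounded_iff.1 hΩb
  set k : RN N → ℝ := (Metric.ball (0 : RN N) (R + 1)).indicator fun z => 1 + ‖z‖ ^ (-a) with hk
  have hki : Integrable k := by
    rw [hk, integrable_indicator_iff Metric.isOpen_ball.measurableSet]
    refine Integrable.add (integrableOn_const Metric.isBounded_ball.measure_lt_top.ne) ?_
    refine integrableOn_ball_of_norm_le_rpow (C := 1) (α := a) (by simpa using hN)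
      (by simpa using haN) (Eventually.of_forall fun z => ?_) ?_
    · rw [Real.norm_of_nonneg (by positivity), one_mul]
    · exact (measurable_norm.pow_const _).aestronglyMeasurable
  have hconv := ((integrable_indicator_iff hΩ).2 hφ).ae_convolution_exists
    (ContinuousLinearMap.mul ℝ ℝ) hki
  filter_upwards [hconv] with x hx hxΩ
  have hx' : IntegrableOn (fun t => Ω.indicator φ t * k (x - t)) Ω := hx.integrable.integrableOn
  have hden : Measurable fun y => dist x y ^ μ x y :=
    (measurable_const.dist measurable_id).pow
      (hμc.comp (Continuous.prodMk_right x)).measurable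
  refine Integrable.mono hx'
    (hφ.aestronglyMeasurable.div₀ hden.aestronglyMeasurable) ?_
  refine (ae_restrict_iff' hΩ).2 (Eventually.of_forall fun y hy => ?_)
  have hmem : x - y ∈ Metric.ball (0 : RN N) (R + 1) := by
    rw [mem_ball_zero_iff, ← dist_eq_norm]
    have := hR hxΩ hy
    linarith
  rw [indicator_of_mem hy, hk, indicator_of_mem hmem, norm_mul, div_eq_mul_inv, norm_mul]
  gcongr
  rw [Real.norm_of_nonneg (by positivity), Real.norm_of_nonneg (by positivity), ← dist_eq_norm]
  exact inv_rpow_le_one_add_rpow_neg dist_nonneg (hμ0 x y) (hμa x y)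

lemma integrableOn_of_integrableOn_div_dist_rpow (hN : 1 ≤ N) (hΩ : MeasurableSet Ω)
    (hΩb : Bornology.IsBounded Ω) (hμc : Continuous fun z : RN N × RN N => μ z.1 z.2)
    (hμ0 : ∀ x y, 0 < μ x y) (hμa : ∀ x y, μ x y ≤ a) {φ : RN N → ℝ} {x : RN N} (hx : x ∈ Ω)
    (h : IntegrableOn (fun y => φ y / dist x y ^ μ x y) Ω) : IntegrableOn φ Ω := by
  obtain ⟨R, hR⟩ := Metric.isBounded_iff.1 hΩb
  have hden : Measurable fun y => dist x y ^ μ x y :=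
    (measurable_const.dist measurable_id).pow
      (hμc.comp (Continuous.prodMk_right x)).measurable
  have hbd : IntegrableOn (fun y => dist x y ^ μ x y * (φ y / dist x y ^ μ x y)) Ω := by
    refine Integrable.bdd_mul (c := max 1 R ^ a) h hden.aestronglyMeasurable ?_
    refine (ae_restrict_iff' hΩ).2 (Eventually.of_forall fun y hy => ?_)
    rw [Real.norm_of_nonneg (by positivity)]
    calc dist x y ^ μ x y ≤ max 1 R ^ μ x y :=
          Real.rpow_le_rpow dist_nonneg ((hR hx hy).trans (le_max_right _ _)) (hμ0 x y).le
      _ ≤ max 1 R ^ a := Real.rpow_le_rpow_of_exponent_le (le_max_left _ _) (hμa x y)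
  have : Nonempty (Fin N) := ⟨⟨0, hN⟩⟩
  have hne : ∀ᵐ y : RN N ∂(volume.restrict Ω), y ≠ x :=
    ae_restrict_of_ae (by simp [ae_iff])
  refine Integrable.congr hbd ?_
  filter_upwards [hne] with y hy
  have : 0 < dist x y ^ μ x y := Real.rpow_pos_of_pos (dist_pos.2 hy.symm) _
  field_simp

/-- Comparison of the two iterated integrals under `Θ G ≤ 2 φ`, allowing for divergence. -/
lemma iterated_integral_eq_zero_or_le (hN : 1 ≤ N) (hΩ : MeasurableSet Ω)
    (hΩb : Bornology.IsBounded Ω) (hμc : Continuous fun z : RN N × RN N => μ z.1 z.2)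
    (hμ0 : ∀ x y, 0 < μ x y) (hμa : ∀ x y, μ x y ≤ a) (haN : a < N) {Θ : ℝ} (hΘ : 0 < Θ)
    {G φ : RN N → ℝ} (hG : ∀ᵐ x, x ∈ Ω → 0 ≤ G x) (hGφ : ∀ᵐ x, x ∈ Ω → Θ * G x ≤ 2 * φ x) :
    (∫ x in Ω, ∫ y in Ω, G x * φ y / dist x y ^ μ x y) = 0 ∨
      (1 / 2) * (∫ x in Ω, ∫ y in Ω, G x * G y / dist x y ^ μ x y) ≤
        (1 / Θ) * ∫ x in Ω, ∫ y in Ω, G x * φ y / dist x y ^ μ x y := by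
  simp_rw [mul_div_assoc, integral_const_mul]
  by_cases hφ : IntegrableOn φ Ω
  swap
  · left
    refine setIntegral_eq_zero_of_forall_eq_zero fun x hx => ?_
    rw [integral_undef, mul_zero]
    exact fun h => hφ (integrableOn_of_integrableOn_div_dist_rpow hN hΩ hΩb hμc hμ0 hμa hx h)
  by_cases hout : IntegrableOn (fun x => G x * ∫ y in Ω, φ y / dist x y ^ μ x y) Ω
  swap
  · exact Or.inl (integral_undef hout)
  right
  have hG' := (ae_restrict_iff' hΩ).2 hG
  have hGφ' := (ae_restrict_iff' hΩ).2 hGφ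
  have hpot := (ae_restrict_iff' hΩ).2
    (ae_integrableOn_div_dist_rpow hN hΩ hΩb hμc hμ0 hμa haN hφ)
  have key : (∫ x in Ω, G x * ∫ y in Ω, G y / dist x y ^ μ x y) ≤
      ∫ x in Ω, (2 / Θ) * (G x * ∫ y in Ω, φ y / dist x y ^ μ x y) := by
    refine integral_mono_of_nonneg ?_ (Integrable.const_mul hout _) ?_
    · filter_upwards [hG'] with x hx
      refine mul_nonneg hx (integral_nonneg_of_ae ?_)
      filter_upwards [hG'] with y hy
      exact div_nonneg hy (by positivity)
    · filter_upwards [hG', hpot] with x hx hxi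
      rw [mul_left_comm, ← integral_const_mul (2 / Θ)]
      refine mul_le_mul_of_nonneg_left (integral_mono_of_nonneg ?_ (hxi.const_mul _) ?_) hx
      · filter_upwards [hG'] with y hy
        exact div_nonneg hy (by positivity)
      · filter_upwards [hGφ'] with y hy
        rw [← mul_div_assoc]
        gcongr
        rw [div_mul_eq_mul_div, le_div_iff₀ hΘ]
        linarith
  rw [integral_const_mul] at key
  calc _ ≤ (1 / 2) * (2 / Θ * ∫ x in Ω, G x * ∫ y in Ω, φ y / dist x y ^ μ x y) := by gcongr
    _ = _ := by ring

end Riesz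

lemma le_of_rpow_mul_le {t P κ K : ℝ} (hP : 1 < P) (hκ : 0 < κ) (ht : 1 ≤ t)
    (h : κ * t ^ P ≤ K * t) : t ≤ (K / κ) ^ (1 / (P - 1)) := by
  have ht0 : 0 < t := by linarith
  have hP0 : 0 < P - 1 := by linarith
  have h1 : t ^ (P - 1) ≤ K / κ := by
    rw [Real.rpow_sub_one ht0.ne', le_div_iff₀ hκ, div_mul_eq_mul_div, div_le_iff₀ ht0]
    linarith
  calc t = (t ^ (P - 1)) ^ (1 / (P - 1)) := by
        rw [← Real.rpow_mul ht0.le, mul_one_div_cancel hP0.ne', Real.rpow_one]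
    _ ≤ _ := Real.rpow_le_rpow (by positivity) h1 (by positivity)

theorem statement14
    {N : ℕ} (hN : 2 ≤ N) (Ω : Set (RN N))
    (hΩo : IsOpen Ω) (hΩb : Bornology.IsBounded Ω) (hΩne : Ω.Nonempty)
    (s p μ q : RN N → RN N → ℝ) (f : RN N → ℝ → ℝ) (M Θ : ℝ) (r : RN N → ℝ)
    (hs : S1 s) (hp : P1 s p) (hμ : Mu1 μ) (hq : CPlus2 q)
    (hqμ : ∀ x y, 2 / q x y + μ x y / (N : ℝ) = 2)
    (hf : Caratheodory f)
    (hr : CPlusOn univ r) (hrM : MemM s p q r) (hrp : sup2 p < infOn univ r)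
    (hf1 : F1 Ω f M r) (hΘ : sup2 p < Θ) (hf2 : F2 Ω f Θ)
    (c : ℝ) (u : ℕ → RN N → ℝ)
    (hmem : ∀ m, MemX0 Ω s p (fun x => p x x) (u m))
    (hJ : Tendsto (fun m => Jfun Ω s p μ f (u m)) atTop (nhds c))
    (hJ' : ∀ ε : ℝ, 0 < ε → ∃ M₀ : ℕ, ∀ m : ℕ, M₀ ≤ m →
      ∀ w : RN N → ℝ, MemX0 Ω s p (fun x => p x x) w → x0Norm s p w ≤ 1 →
        |Jderiv Ω s p μ f (u m) w| ≤ ε) :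
    ∃ C : ℝ, ∀ m : ℕ, x0Norm s p (u m) ≤ C := by
  obtain ⟨hsc, -, -, -, -⟩ := hs
  obtain ⟨⟨hpc, hp1, hpb⟩, -, -⟩ := hp
  obtain ⟨-, hμb, hμ1, hμN⟩ := hμ
  obtain ⟨hqc, hq1, hqb⟩ := hq
  have hN0 : (0 : ℝ) < N := by exact_mod_cast (by omega : 0 < N)
  have hΩ := hΩo.measurableSet
  have hpl : ∀ x y, inf2 p ≤ p x y := inf2_le (by linarith)
  have hpP : ∀ x y, p x y ≤ sup2 p := le_sup2 hpb
  have hp0 : ∀ x y, 0 < p x y := fun x y => by linarith [hpl x y]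
  have hP1 : 1 < sup2 p := by linarith [hpl 0 0, hpP 0 0]
  have hΘ0 : 0 < Θ := by linarith
  have hμ0 : ∀ x y, 0 < μ x y := fun x y => hμ1.trans_le (inf2_le hμ1 x y)
  have hμc : Continuous fun z : RN N × RN N => μ z.1 z.2 := by
    have heq : (fun z : RN N × RN N => μ z.1 z.2) = fun z => N * (2 - 2 / q z.1 z.2) := by
      funext z
      rw [← eq_sub_of_add_eq' (hqμ z.1 z.2), mul_div_cancel₀ _ hN0.ne']
    rw [heq]
    refine continuous_const.mul (continuous_const.sub (continuous_const.div hqc fun z => ?_))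
    linarith [inf2_le (by linarith : 0 < inf2 q) z.1 z.2]
  have hκ : 0 < 1 / sup2 p - 1 / Θ :=
    sub_pos.2 (one_div_lt_one_div_of_lt (by linarith) hΘ)
  set κ := 1 / sup2 p - 1 / Θ with hκdef
  obtain ⟨M₀, hM₀⟩ := hJ' 1 one_pos
  set K := |c| + 1 + 4 with hK
  have hev : ∀ᶠ m in atTop, x0Norm s p (u m) ≤ max 2 (2 * (K / κ) ^ (1 / (inf2 p - 1))) := by
    filter_upwards [eventually_ge_atTop M₀, hJ.eventually (gt_mem_nhds (lt_add_one c))]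
      with m hm hJm
    by_cases hn2 : x0Norm s p (u m) ≤ 2
    · exact hn2.trans (le_max_left _ _)
    push Not at hn2
    set n := x0Norm s p (u m) with hn
    have hint := integrable_gagliardoDensity hΩ hsc hpc hp0 hpP (hmem m)
    set A := ∫ z, gagliardoDensity s p (u m) z with hA
    have hlow : (n / 2) ^ inf2 p ≤ A :=
      rpow_le_integral_gagliardoDensity hp0 hpl hint (by linarith) (by linarith)
    have hA0 : 0 ≤ A := integral_nonneg gagliardoDensity_nonneg
    obtain ⟨l, hl0, hln, hl1⟩ := exists_gmodular_lt_one (s := s) (p := p) (u := u m)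
      (L := 2 * n) (by linarith) (by linarith)
    set B := choquardRHS Ω μ f (u m) (u m) with hB
    have hAB : |A - B| ≤ 2 * n := by
      have h1 := hM₀ m hm _ ((hmem m).div hl0)
        (x0Norm_le_one (by rwa [gmodular_div _ hl0, mul_one]))
      rw [Jderiv, energyLHS_div, choquardRHS_div, energyLHS_self hp0, ← sub_div, abs_div,
        abs_of_pos hl0, div_le_one hl0] at h1
      linarith
    have hJA : A / sup2 p - (1 / 2) * (∫ x in Ω, ∫ y in Ω,
        Fant f x (u m x) * Fant f y (u m y) / dist x y ^ μ x y) ≤ Jfun Ω s p μ f (u m) := by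
      unfold Jfun
      refine sub_le_sub_right ?_ _
      rw [hA, ← integral_div]
      refine integral_mono_of_nonneg (Eventually.of_forall fun z =>
        div_nonneg (gagliardoDensity_nonneg z) (by linarith)) ?_ (Eventually.of_forall fun z => ?_)
      · refine Integrable.mono hint ?_ (Eventually.of_forall fun z => ?_)
        · have := (measurable_gagliardoDensity hsc hpc (hmem m).1).div hpc.measurable
          refine this.aestronglyMeasurable.congr (Eventually.of_forall fun z => ?_)
          simp only [gagliardoDensity, Pi.div_apply]
          rw [div_div, mul_comm (p z.1 z.2)]
        · have h0 := gagliardoDensity_nonneg (s := s) (p := p) (u := u m) z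
          rw [mul_comm, ← div_div, norm_div, Real.norm_of_nonneg (hp0 z.1 z.2).le]
          exact div_le_self (norm_nonneg _) (by linarith [hpl z.1 z.2])
      · dsimp only
        rw [mul_comm, ← div_div]
        exact div_le_div_of_nonneg_left (gagliardoDensity_nonneg z) (hp0 _ _) (hpP _ _)
    have hG : ∀ᵐ x, x ∈ Ω → 0 ≤ Fant f x (u m x) := by
      filter_upwards [hf2] with x hx hxΩ
      by_cases h0 : u m x = 0
      · simp [h0, Fant]
      · exact (pos_of_mul_pos_right (hx hxΩ _ h0).1 hΘ0.le).le
    have hGφ : ∀ᵐ x, x ∈ Ω → Θ * Fant f x (u m x) ≤ 2 * (f x (u m x) * u m x) := by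
      filter_upwards [hf2] with x hx hxΩ
      by_cases h0 : u m x = 0
      · simp [h0, Fant]
      · linarith [(hx hxΩ _ h0).2]
    have hBC := iterated_integral_eq_zero_or_le (by omega) hΩ hΩb hμc hμ0 (le_sup2 hμb) hμN hΘ0
      hG hGφ
    simp_rw [← mul_assoc] at hBC
    change B = 0 ∨ _ ≤ 1 / Θ * B at hBC
    have hmain : κ * A ≤ |c| + 1 + 2 * n := by
      have hAB' := abs_le.1 hAB
      have hΘ1 : 1 / Θ ≤ 1 := (div_le_one hΘ0).2 (by linarith)
      have hP1' : 1 / sup2 p ≤ 1 := (div_le_one (by linarith)).2 hP1.le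
      have hΘp : 0 < 1 / Θ := by positivity
      have hc := le_abs_self c
      rcases hBC with h | h
      · rw [h, sub_zero] at hAB'
        have : κ * A ≤ 1 * A := by gcongr; linarith
        linarith [abs_nonneg c]
      · have h3 : 1 / Θ * (B - A) ≤ 1 * (2 * n) :=
          (mul_le_mul_of_nonneg_left (by linarith) hΘp.le).trans
            (mul_le_mul_of_nonneg_right hΘ1 (by linarith))
        have h4 : κ * A = A / sup2 p - 1 / Θ * A := by rw [hκdef]; ring
        linarith
    have hfin := le_of_rpow_mul_le (t := n / 2) (K := K) hp1 hκ (by linarith) (by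
      have h5 : κ * (n / 2) ^ inf2 p ≤ κ * A := by gcongr
      have h6 : |c| + 1 ≤ (|c| + 1) * (n / 2) :=
        le_mul_of_one_le_right (by positivity) (by linarith)
      rw [hK]
      linarith)
    exact le_max_of_le_right (by linarith)
  obtain ⟨C, hC⟩ := (IsBoundedUnder.bddAbove_range ⟨_, eventually_map.2 hev⟩)
  exact ⟨C, fun m => hC ⟨m, rfl⟩⟩

end VarOrderChoquard
end
end

section
/- Let Ω ⊂ ℝ^N (N ≥ 2) be a smooth bounded domain, assume (S1), (P1), (μ1), let q ∈ C₊(ℝ^N×ℝ^N) satisfy 2/q(x,y) + μ(x,y)/N = 2, and let f satisfy (F1) with r ∈ C₊(ℝ^N)∩𝓜. Then there exists a constant c > 0, independent of u, such that for every u ∈ X₀ (extended by 0 outside Ω), ‖F(·,u(·))‖_{L^{q⁺}(Ω)} ≤ c·max{‖u‖_{X₀}^{r⁺}, ‖u‖_{X₀}^{r⁻}}, and the analogous estimate holds with q⁺ replaced by q⁻. -/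
open MeasureTheory Set Filter ENNReal

noncomputable section

namespace VarOrderChoquard

variable {N : ℕ}

lemma infOn_univ_le {g : RN N → ℝ} (h : 0 < infOn univ g) (x : RN N) : infOn univ g ≤ g x := by
  refine csInf_le ?_ ⟨x, mem_univ x, rfl⟩
  by_contra hb
  rw [infOn, Real.sInf_of_not_bddBelow hb] at h
  exact lt_irrefl _ h

lemma le_supOn_univ {g : RN N → ℝ} (h : BddAbove (g '' univ)) (x : RN N) :
    g x ≤ supOn univ g :=
  le_csSup h ⟨x, mem_univ x, rfl⟩

/-- Measurable functions vanishing a.e. outside `Ω` whose Gagliardo modular is at most `1`. -/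
def UnitModular (Ω : Set (RN N)) (s p : RN N → RN N → ℝ) (v : RN N → ℝ) : Prop :=
  Measurable v ∧ (∀ᵐ x, x ∉ Ω → v x = 0) ∧ gmodular univ s p v 1 ≤ 1

/-- The level sets `{λ < |v|}` near `x₀` have measure `O(λ^{-m})`, uniformly over the
functions `v` in the unit modular ball. -/
def TailDecay (Ω : Set (RN N)) (s p : RN N → RN N → ℝ) (x₀ : RN N) (m : ℝ) : Prop :=
  ∃ δ > 0, ∃ C > 0, ∀ v, UnitModular Ω s p v → ∀ t : ℝ, 1 ≤ t →
    volume ({x | t < |v x|} ∩ Metric.ball x₀ δ) ≤ ENNReal.ofReal (C * t ^ (-m))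

/-- A set on which the Gagliardo integrand is at least `a / b` has measure at most `b / a`. -/
lemma volume_le_of_gmodular_le_one {s p : RN N → RN N → ℝ} {v : RN N → ℝ}
    (hv : gmodular univ s p v 1 ≤ 1) (hp : ∀ x y, 0 ≤ p x y) (hs : ∀ x y, 0 ≤ s x y)
    {S : Set (RN N × RN N)} (hS : MeasurableSet S) {a b : ℝ} (ha : 0 < a) (hb : 0 < b)
    (hSa : ∀ z ∈ S, a ≤ |v z.1 - v z.2| ^ p z.1 z.2)
    (hSb : ∀ z ∈ S, dist z.1 z.2 ^ ((N : ℝ) + s z.1 z.2 * p z.1 z.2) ≤ b) :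
    volume S ≤ ENNReal.ofReal (b / a) := by
  have h1 : ENNReal.ofReal (a / b) * volume S ≤ 1 := by
    refine le_trans ?_ hv
    rw [gmodular, Measure.restrict_univ, ← setLIntegral_const]
    refine le_trans (setLIntegral_mono' hS fun z hz => ?_) (setLIntegral_le_lintegral S _)
    have he : 0 ≤ (N : ℝ) + s z.1 z.2 * p z.1 z.2 :=
      add_nonneg (Nat.cast_nonneg _) (mul_nonneg (hs _ _) (hp _ _))
    rw [ENNReal.ofReal_div_of_pos hb, div_one,
      ENNReal.ofReal_rpow_of_nonneg (abs_nonneg _) (hp _ _),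
      ENNReal.ofReal_rpow_of_nonneg dist_nonneg he]
    exact ENNReal.div_le_div (ENNReal.ofReal_le_ofReal (hSa z hz))
      (ENNReal.ofReal_le_ofReal (hSb z hz))
  have h2 : ENNReal.ofReal (b / a) * (ENNReal.ofReal (a / b) * volume S) = volume S := by
    rw [← mul_assoc, ← ENNReal.ofReal_mul (by positivity)]
    have : b / a * (a / b) = 1 := by field_simp
    rw [this, ENNReal.ofReal_one, one_mul]
  calc volume S = ENNReal.ofReal (b / a) * (ENNReal.ofReal (a / b) * volume S) := h2.symm
    _ ≤ ENNReal.ofReal (b / a) * 1 := by gcongr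
    _ = _ := mul_one _

lemma volume_ball_eq (x : RN N) {ρ : ℝ} (hρ : 0 < ρ) :
    volume (Metric.ball x ρ) =
      ENNReal.ofReal (ρ ^ N * (volume (Metric.ball (0 : RN N) 1)).toReal) := by
  rw [Measure.addHaar_ball_of_pos volume x hρ, ENNReal.ofReal_mul (by positivity),
    ENNReal.ofReal_toReal measure_ball_lt_top.ne, finrank_euclideanSpace, Fintype.card_fin]

lemma TailDecay.mono {Ω : Set (RN N)} {s p : RN N → RN N → ℝ} {x₀ : RN N} {m m' : ℝ}
    (h : TailDecay Ω s p x₀ m) (hm : m' ≤ m) : TailDecay Ω s p x₀ m' := by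
  obtain ⟨δ, hδ, C, hC, H⟩ := h
  refine ⟨δ, hδ, C, hC, fun v hv t ht => (H v hv t ht).trans (ENNReal.ofReal_le_ofReal ?_)⟩
  gcongr

/-- A Poincaré-type estimate: comparing with a ball outside `Ω`, where `v` vanishes. -/
lemma tailDecay_one (hN : 2 ≤ N) {Ω : Set (RN N)} (hΩ : IsOpen Ω) (hΩb : Bornology.IsBounded Ω)
    {s p : RN N → RN N → ℝ} (hp1 : ∀ x y, 1 ≤ p x y) (hs0 : ∀ x y, 0 ≤ s x y)
    (hsp : ∀ x y, s x y * p x y ≤ N) (x₀ : RN N) : TailDecay Ω s p x₀ 1 := by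
  obtain ⟨R₀, hR₀⟩ := hΩb.subset_ball 0
  set R := max R₀ 1 with hR
  have hR1 : 1 ≤ R := le_max_right _ _
  have hΩR : Ω ⊆ Metric.ball 0 R := hR₀.trans (Metric.ball_subset_ball (le_max_left _ _))
  let e : RN N := EuclideanSpace.single ⟨0, by omega⟩ (R + 1)
  have he : ‖e‖ = R + 1 := by
    rw [show e = EuclideanSpace.single ⟨0, by omega⟩ (R + 1) from rfl, PiLp.norm_single,
      Real.norm_eq_abs, abs_of_nonneg (by linarith)]
  set Z := Metric.ball e 1 with hZ
  set w := (volume Z).toReal with hw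
  have hw0 : 0 < w :=
    ENNReal.toReal_pos (Metric.measure_ball_pos volume e one_pos).ne' measure_ball_lt_top.ne
  have hZΩ : ∀ y ∈ Z, y ∉ Ω := by
    intro y hy hyΩ
    have h1 := hΩR hyΩ
    rw [mem_ball_zero_iff] at h1
    rw [hZ, Metric.mem_ball, dist_eq_norm] at hy
    have := norm_sub_norm_le e y
    rw [norm_sub_rev] at this
    linarith
  set D := (2 * R + 2) ^ ((N : ℝ) + N) with hD
  have hD0 : 0 < D := by positivity
  refine ⟨1, one_pos, D / w, by positivity, fun v hv t ht => ?_⟩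
  obtain ⟨hvm, hvΩ, hv1⟩ := hv
  have ht0 : 0 < t := by linarith
  set A := {x | t < |v x|} ∩ Ω with hA
  set Z' := Z ∩ {y | v y = 0} with hZ'
  have hAm : MeasurableSet A := (measurableSet_lt measurable_const hvm.abs).inter hΩ.measurableSet
  have hZ'm : MeasurableSet Z' :=
    measurableSet_ball.inter (measurableSet_eq_fun hvm measurable_const)
  have hZZ' : volume Z ≤ volume Z' := by
    refine measure_mono_ae ?_
    filter_upwards [hvΩ] with y hy hyZ
    exact ⟨hyZ, hy (hZΩ y hyZ)⟩
  have hAA : volume ({x | t < |v x|} ∩ Metric.ball x₀ 1) ≤ volume A := by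
    refine measure_mono_ae ?_
    filter_upwards [hvΩ] with x hx hxA
    refine ⟨hxA.1, ?_⟩
    by_contra hxΩ
    have h1 : t < |v x| := hxA.1
    rw [hx hxΩ, abs_zero] at h1
    linarith
  have key := volume_le_of_gmodular_le_one hv1 (fun x y => zero_le_one.trans (hp1 x y)) hs0
    (hAm.prod hZ'm) ht0 hD0
    (by
      rintro ⟨x, y⟩ ⟨hx, hy⟩
      have h1 : t < |v x| := hx.1
      have h2 : v y = 0 := hy.2
      simp only [h2, sub_zero]
      calc t ≤ |v x| := h1.le
        _ = |v x| ^ (1 : ℝ) := (Real.rpow_one _).symm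
        _ ≤ |v x| ^ p x y := Real.rpow_le_rpow_of_exponent_le (by linarith) (hp1 x y))
    (by
      rintro ⟨x, y⟩ ⟨hx, hy⟩
      have h1 := hΩR hx.2
      rw [mem_ball_zero_iff] at h1
      have h2 := hy.1
      rw [hZ, Metric.mem_ball] at h2
      have h3 : dist x y ≤ 2 * R + 2 := by
        have h4 : dist x e ≤ ‖x‖ + ‖e‖ := dist_le_norm_add_norm x e
        have := dist_triangle x e y
        rw [dist_comm e y] at this
        linarith
      have h5 : 0 ≤ (N : ℝ) + s x y * p x y :=
        add_nonneg (Nat.cast_nonneg _) (mul_nonneg (hs0 _ _) (zero_le_one.trans (hp1 x y)))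
      calc dist x y ^ ((N : ℝ) + s x y * p x y)
          ≤ (2 * R + 2) ^ ((N : ℝ) + s x y * p x y) := Real.rpow_le_rpow dist_nonneg h3 h5
        _ ≤ D := Real.rpow_le_rpow_of_exponent_le (by linarith) (by linarith [hsp x y]))
  rw [Measure.volume_eq_prod, Measure.prod_prod] at key
  have hwZ : ENNReal.ofReal w ≤ volume Z' := by
    rwa [hw, ENNReal.ofReal_toReal measure_ball_lt_top.ne]
  have h6 : volume A * ENNReal.ofReal w ≤ ENNReal.ofReal (D / t) :=
    le_trans (by gcongr) key
  refine hAA.trans ?_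
  have h7 : volume A ≤ ENNReal.ofReal (D / t) / ENNReal.ofReal w := by
    rw [ENNReal.le_div_iff_mul_le (Or.inl (by simpa using hw0)) (Or.inl ENNReal.ofReal_ne_top)]
    exact h6
  refine h7.trans (le_of_eq ?_)
  rw [← ENNReal.ofReal_div_of_pos hw0, Real.rpow_neg_one]
  congr 1
  field_simp

/-- One step of the bootstrap: a tail exponent `m` improves to `p₀ + m σ₀ / N`. -/
lemma TailDecay.step (hN : 0 < N) {Ω : Set (RN N)} {s p : RN N → RN N → ℝ}
    (hsc : Continuous fun z : RN N × RN N => s z.1 z.2)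
    (hpc : Continuous fun z : RN N × RN N => p z.1 z.2)
    (hp0 : ∀ x y, 0 ≤ p x y) (hs0 : ∀ x y, 0 ≤ s x y) {x₀ : RN N} {m p₀ σ₀ : ℝ}
    (h : TailDecay Ω s p x₀ m) (hm : 0 < m) (hp₀ : 0 ≤ p₀) (hσ₀ : 0 ≤ σ₀)
    (hpp : p₀ < p x₀ x₀) (hσp : σ₀ < s x₀ x₀ * p x₀ x₀) :
    TailDecay Ω s p x₀ (p₀ + m * σ₀ / N) := by
  obtain ⟨δ, hδ, C, hC, H⟩ := h
  have hN' : (0 : ℝ) < N := by exact_mod_cast hN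
  have hev : ∀ᶠ z : RN N × RN N in nhds (x₀, x₀), p₀ < p z.1 z.2 ∧ σ₀ < s z.1 z.2 * p z.1 z.2 :=
    ((hpc.tendsto (x₀, x₀)).eventually_const_lt hpp).and
      (((hsc.mul hpc).tendsto (x₀, x₀)).eventually_const_lt hσp)
  obtain ⟨δ₁, hδ₁, hδ₁'⟩ := Metric.eventually_nhds_iff_ball.1 hev
  set η := min (min δ δ₁ / 2) 1 with hη
  have hη0 : 0 < η := by positivity
  have hη1 : η ≤ 1 := min_le_right _ _
  have hηδ : η + η ≤ δ := by
    have h1 : η ≤ min δ δ₁ / 2 := min_le_left _ _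
    have h2 : min δ δ₁ ≤ δ := min_le_left _ _
    linarith
  have hηδ₁ : η + η ≤ δ₁ := by
    have h1 : η ≤ min δ δ₁ / 2 := min_le_left _ _
    have h2 : min δ δ₁ ≤ δ₁ := min_le_right _ _
    linarith
  set ω := (volume (Metric.ball (0 : RN N) 1)).toReal with hω
  have hω0 : 0 < ω :=
    ENNReal.toReal_pos (Metric.measure_ball_pos volume _ one_pos).ne' measure_ball_lt_top.ne
  set K := (2 * C / ω) ^ (1 / (N : ℝ)) with hK
  have hK0 : 0 < K := by positivity
  have hKN : K ^ N * ω = 2 * C := by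
    rw [hK, ← Real.rpow_natCast, ← Real.rpow_mul (by positivity), one_div_mul_cancel hN'.ne',
      Real.rpow_one]
    field_simp
  have hlim : Tendsto (fun t : ℝ => K * t ^ (-(m / N))) atTop (nhds 0) := by
    have := (tendsto_rpow_neg_atTop (y := m / N) (by positivity)).const_mul K
    rwa [mul_zero] at this
  obtain ⟨t₁, ht₁⟩ := eventually_atTop.1 (hlim.eventually_lt_const hη0)
  set t₀ := max t₁ 1 with ht₀
  have ht₀1 : 1 ≤ t₀ := le_max_right _ _
  set m' := p₀ + m * σ₀ / N with hm'
  have hm'0 : 0 ≤ m' := by positivity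
  set V := (volume (Metric.ball x₀ η)).toReal with hV
  have hV0 : 0 ≤ V := ENNReal.toReal_nonneg
  have hcore : ∀ v, UnitModular Ω s p v → ∀ t : ℝ, t₀ ≤ t →
      volume ({x | 2 * t < |v x|} ∩ Metric.ball x₀ η) ≤
        ENNReal.ofReal (K ^ ((N : ℝ) + σ₀) / C * t ^ (-m')) := by
    intro v hv t ht
    have ht1 : 1 ≤ t := ht₀1.trans ht
    have ht0 : 0 < t := by linarith
    have hvm := hv.1
    set ρ := K * t ^ (-(m / N)) with hρ
    have hρ0 : 0 < ρ := by positivity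
    have hρη : ρ < η := ht₁ t ((le_max_left _ _).trans ht)
    have hρN : ρ ^ N * ω = 2 * (C * t ^ (-m)) := by
      rw [hρ, mul_pow, ← Real.rpow_natCast (t ^ _), ← Real.rpow_mul ht0.le,
        show -(m / N) * (N : ℝ) = -m by field_simp, mul_right_comm, hKN]
      ring
    set A := {x | 2 * t < |v x|} ∩ Metric.ball x₀ η with hA
    have hAm : MeasurableSet A :=
      (measurableSet_lt measurable_const hvm.abs).inter measurableSet_ball
    set S : Set (RN N × RN N) := {z | z.1 ∈ A ∧ dist z.2 z.1 < ρ ∧ |v z.2| ≤ t} with hS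
    have hSm : MeasurableSet S := by
      refine (measurable_fst hAm).inter (MeasurableSet.inter ?_ ?_)
      · exact measurableSet_lt (measurable_snd.dist measurable_fst) measurable_const
      · exact measurableSet_le (hvm.comp measurable_snd).abs measurable_const
    have key := volume_le_of_gmodular_le_one hv.2.2 hp0 hs0 hSm
      (a := t ^ p₀) (b := ρ ^ ((N : ℝ) + σ₀)) (by positivity) (by positivity)
      (by
        rintro ⟨x, y⟩ ⟨hx, hy, hvy⟩
        dsimp only at hx hy hvy ⊢
        have hx2 := hx.2
        rw [Metric.mem_ball] at hx2
        have h3 := hδ₁' (x, y) (by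
          rw [Metric.mem_ball, Prod.dist_eq, max_lt_iff]
          have := dist_triangle y x x₀
          constructor <;> dsimp only <;> linarith)
        have h1 : 2 * t < |v x| := hx.1
        have h2 : t ≤ |v x - v y| := by
          have := abs_sub_abs_le_abs_sub (v x) (v y)
          linarith
        calc t ^ p₀ ≤ t ^ p x y := Real.rpow_le_rpow_of_exponent_le ht1 h3.1.le
          _ ≤ _ := Real.rpow_le_rpow ht0.le h2 (hp0 _ _))
      (by
        rintro ⟨x, y⟩ ⟨hx, hy, hvy⟩
        dsimp only at hx hy hvy ⊢
        have hx2 := hx.2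
        rw [Metric.mem_ball] at hx2
        have h3 := hδ₁' (x, y) (by
          rw [Metric.mem_ball, Prod.dist_eq, max_lt_iff]
          have := dist_triangle y x x₀
          constructor <;> dsimp only <;> linarith)
        have h5 : 0 ≤ (N : ℝ) + s x y * p x y :=
          add_nonneg (Nat.cast_nonneg _) (mul_nonneg (hs0 _ _) (hp0 x y))
        rw [dist_comm]
        calc dist y x ^ ((N : ℝ) + s x y * p x y)
            ≤ ρ ^ ((N : ℝ) + s x y * p x y) := Real.rpow_le_rpow dist_nonneg hy.le h5
          _ ≤ _ := Real.rpow_le_rpow_of_exponent_ge hρ0 (by linarith) (by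
            have := h3.2
            dsimp only at this
            linarith))
    have hsec : ∀ x ∈ A, ENNReal.ofReal (C * t ^ (-m)) ≤ volume (Prod.mk x ⁻¹' S) := by
      intro x hx
      have hx2 := hx.2
      rw [Metric.mem_ball] at hx2
      have hcov : Metric.ball x ρ ⊆
          (Prod.mk x ⁻¹' S) ∪ ({y | t < |v y|} ∩ Metric.ball x₀ δ) := by
        intro y hy
        rw [Metric.mem_ball] at hy
        by_cases hty : t < |v y|
        · refine Or.inr ⟨hty, ?_⟩
          rw [Metric.mem_ball]
          have := dist_triangle y x x₀
          linarith
        · exact Or.inl ⟨hx, hy, not_lt.1 hty⟩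
      have h1 := (measure_mono (μ := volume) hcov).trans (measure_union_le _ _)
      rw [volume_ball_eq x hρ0, ← hω, hρN, two_mul,
        ENNReal.ofReal_add (by positivity) (by positivity)] at h1
      have h2 := h1.trans (add_le_add_right (H v hv t ht1) _)
      exact (ENNReal.add_le_add_iff_right ENNReal.ofReal_ne_top).1 h2
    have hprod : ENNReal.ofReal (C * t ^ (-m)) * volume A ≤ volume S := by
      rw [Measure.volume_eq_prod, Measure.prod_apply hSm, ← setLIntegral_const]
      exact (setLIntegral_mono' hAm hsec).trans (setLIntegral_le_lintegral _ _)
    have hCt : 0 < C * t ^ (-m) := by positivity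
    have h7 : volume A ≤
        ENNReal.ofReal (ρ ^ ((N : ℝ) + σ₀) / t ^ p₀) / ENNReal.ofReal (C * t ^ (-m)) := by
      rw [ENNReal.le_div_iff_mul_le (Or.inl (by simpa using hCt))
        (Or.inl ENNReal.ofReal_ne_top), mul_comm]
      exact hprod.trans key
    refine h7.trans (le_of_eq ?_)
    rw [← ENNReal.ofReal_div_of_pos hCt]
    congr 1
    have e1 : ρ ^ ((N : ℝ) + σ₀) = K ^ ((N : ℝ) + σ₀) * t ^ (-m - m * σ₀ / N) := by
      rw [hρ, Real.mul_rpow hK0.le (by positivity), ← Real.rpow_mul ht0.le]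
      congr 2
      field_simp
      ring
    have e2 : t ^ (-m - m * σ₀ / N) = t ^ (-m') * t ^ p₀ * t ^ (-m) := by
      rw [← Real.rpow_add ht0, ← Real.rpow_add ht0]
      congr 1
      rw [hm']
      ring
    rw [e1, e2]
    field_simp
  refine ⟨η, hη0, K ^ ((N : ℝ) + σ₀) / C * 2 ^ m' + V * (2 * t₀) ^ m', by positivity,
    fun v hv t ht => ?_⟩
  have ht0 : 0 < t := by linarith
  by_cases htt : t₀ ≤ t / 2
  · have h1 := hcore v hv (t / 2) htt
    rw [mul_div_cancel₀ t two_ne_zero] at h1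
    refine h1.trans (ENNReal.ofReal_le_ofReal ?_)
    rw [Real.div_rpow ht0.le two_pos.le, Real.rpow_neg two_pos.le m', div_inv_eq_mul, add_mul]
    have : 0 ≤ V * (2 * t₀) ^ m' * t ^ (-m') := by positivity
    linarith
  · have h1 : volume ({x | t < |v x|} ∩ Metric.ball x₀ η) ≤ ENNReal.ofReal V := by
      rw [hV, ENNReal.ofReal_toReal measure_ball_lt_top.ne]
      exact measure_mono inter_subset_right
    refine h1.trans (ENNReal.ofReal_le_ofReal ?_)
    have h2 : 1 ≤ (2 * t₀) ^ m' * t ^ (-m') := by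
      rw [Real.rpow_neg ht0.le, ← div_eq_mul_inv, one_le_div (by positivity)]
      exact Real.rpow_le_rpow ht0.le (by linarith) hm'0
    have h3 : 0 ≤ K ^ ((N : ℝ) + σ₀) / C * 2 ^ m' * t ^ (-m') := by positivity
    calc V ≤ V * ((2 * t₀) ^ m' * t ^ (-m')) := le_mul_of_one_le_right hV0 h2
      _ ≤ _ := by rw [add_mul, mul_assoc V]; linarith

/-- Iterating the bootstrap reaches every exponent below the critical one. -/
lemma exists_tailDecay_gt (hN : 2 ≤ N) {Ω : Set (RN N)} (hΩ : IsOpen Ω)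
    (hΩb : Bornology.IsBounded Ω) {s p : RN N → RN N → ℝ}
    (hsc : Continuous fun z : RN N × RN N => s z.1 z.2)
    (hpc : Continuous fun z : RN N × RN N => p z.1 z.2)
    (hp1 : ∀ x y, 1 ≤ p x y) (hs0 : ∀ x y, 0 < s x y)
    (hsp : ∀ x y, s x y * p x y < N) (x₀ : RN N) {γ : ℝ} (hγ : γ < pstar s p x₀) :
    ∃ m, γ < m ∧ TailDecay Ω s p x₀ m := by
  have hN' : (0 : ℝ) < N := by exact_mod_cast (by omega : 0 < N)
  by_contra! hcon
  set T := {m | TailDecay Ω s p x₀ m} with hT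
  have h1T : (1 : ℝ) ∈ T :=
    tailDecay_one hN hΩ hΩb hp1 (fun x y => (hs0 x y).le) (fun x y => (hsp x y).le) x₀
  have hbdd : BddAbove T := ⟨γ, fun m hm => not_lt.1 fun h => hcon m h hm⟩
  set B := sSup T with hB
  have hB1 : 1 ≤ B := le_csSup hbdd h1T
  have hBγ : B ≤ γ := csSup_le ⟨1, h1T⟩ fun m hm => not_lt.1 fun h => hcon m h hm
  have hP := hp1 x₀ x₀
  have hσ0 : 0 < s x₀ x₀ * p x₀ x₀ := mul_pos (hs0 _ _) (by linarith)
  have hσN := hsp x₀ x₀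
  set P := p x₀ x₀ with hPdef
  set σ := s x₀ x₀ * P with hσ
  have hlt : B < P + B * σ / N := by
    have h1 : B < N * P / (N - σ) := hBγ.trans_lt hγ
    rw [lt_div_iff₀ (by linarith)] at h1
    have h2 : B * σ / N * N = B * σ := by field_simp
    nlinarith
  have hcont : Tendsto (fun ε : ℝ => (P - ε) + (B - ε) * (σ - ε) / N) (nhdsWithin 0 (Ioi 0))
      (nhds (P + B * σ / N)) := by
    have : Continuous fun ε : ℝ => (P - ε) + (B - ε) * (σ - ε) / N := by fun_prop
    have := this.tendsto 0
    simp only [sub_zero] at this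
    exact this.mono_left nhdsWithin_le_nhds
  have hsmall : ∀ᶠ ε : ℝ in nhdsWithin 0 (Ioi 0), ε < min 1 σ :=
    (eventually_lt_nhds (lt_min one_pos hσ0)).filter_mono nhdsWithin_le_nhds
  obtain ⟨ε, ⟨h1, h2⟩, h3⟩ :=
    (((hcont.eventually_const_lt hlt).and hsmall).and self_mem_nhdsWithin).exists
  have hε0 : 0 < ε := h3
  have hε1 : ε < 1 := h2.trans_le (min_le_left _ _)
  have hεσ : ε < σ := h2.trans_le (min_le_right _ _)
  obtain ⟨m, hmT, hmB⟩ := exists_lt_of_lt_csSup ⟨1, h1T⟩ (show B - ε < sSup T by linarith)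
  have hdec : TailDecay Ω s p x₀ (B - ε) := TailDecay.mono hmT hmB.le
  have := hdec.step (by omega) hsc hpc (fun x y => zero_le_one.trans (hp1 x y))
    (fun x y => (hs0 x y).le) (p₀ := P - ε) (σ₀ := σ - ε) (by linarith) (by linarith)
    (by linarith) (by linarith) (by linarith)
  exact absurd (le_csSup hbdd this) (not_le.2 h1)

lemma TailDecay.exists_lintegral_le {Ω : Set (RN N)} {s p : RN N → RN N → ℝ} {x₀ : RN N}
    {m γ : ℝ} (h : TailDecay Ω s p x₀ m) (hγ : 0 < γ) (hγm : γ < m) :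
    ∃ δ > 0, ∃ C : ℝ≥0∞, C ≠ ⊤ ∧ ∀ v, UnitModular Ω s p v →
      ∫⁻ x in Metric.ball x₀ δ, ENNReal.ofReal (|v x| ^ γ) ≤ C := by
  obtain ⟨δ, hδ, C, hC, H⟩ := h
  set V := volume (Metric.ball x₀ δ) with hV
  have hVtop : V ≠ ⊤ := measure_ball_lt_top.ne
  refine ⟨δ, hδ, ENNReal.ofReal γ * (V * (∫⁻ t in Ioc (0 : ℝ) 1, ENNReal.ofReal (t ^ (γ - 1))) +
    ∫⁻ t in Ioi (1 : ℝ), ENNReal.ofReal (C * t ^ (γ - 1 - m))), ?_, fun v hv => ?_⟩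
  · refine ENNReal.mul_ne_top ENNReal.ofReal_ne_top (ENNReal.add_ne_top.2
      ⟨ENNReal.mul_ne_top hVtop (Integrable.lintegral_lt_top ?_).ne,
        (Integrable.lintegral_lt_top ?_).ne⟩)
    · exact (intervalIntegrable_iff_integrableOn_Ioc_of_le zero_le_one).1
        (intervalIntegral.intervalIntegrable_rpow' (by linarith))
    · exact (integrableOn_Ioi_rpow_of_lt (by linarith) one_pos).const_mul C
  · have hvm := hv.1
    rw [lintegral_rpow_eq_lintegral_meas_lt_mul _ (Eventually.of_forall fun x => abs_nonneg (v x))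
      hvm.abs.aemeasurable hγ]
    refine mul_le_mul_right ?_ _
    rw [← Ioc_union_Ioi_eq_Ioi (zero_le_one' ℝ)]
    refine (lintegral_union_le _ _ _).trans (add_le_add ?_ ?_)
    · rw [← lintegral_const_mul' _ _ hVtop]
      refine lintegral_mono fun t => mul_le_mul_left ?_ _
      rw [hV, ← Measure.restrict_apply_univ (Metric.ball x₀ δ)]
      exact measure_mono (subset_univ _)
    · refine setLIntegral_mono' measurableSet_Ioi fun t ht => ?_
      have ht1 : 1 < t := ht
      have ht0 : 0 < t := by linarith
      rw [Measure.restrict_apply (measurableSet_lt measurable_const hvm.abs)]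
      refine (mul_le_mul_left (H v hv t ht1.le) _).trans (le_of_eq ?_)
      rw [← ENNReal.ofReal_mul (by positivity), mul_assoc, ← Real.rpow_add ht0]
      congr 3
      ring

/-- Subcritical fractional Sobolev embedding with variable exponents, in modular form. -/
lemma exists_lintegral_rpow_le (hN : 2 ≤ N) {Ω : Set (RN N)} (hΩ : IsOpen Ω)
    (hΩb : Bornology.IsBounded Ω) {s p : RN N → RN N → ℝ}
    (hsc : Continuous fun z : RN N × RN N => s z.1 z.2)
    (hpc : Continuous fun z : RN N × RN N => p z.1 z.2)
    (hp1 : ∀ x y, 1 ≤ p x y) (hs0 : ∀ x y, 0 < s x y)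
    (hsp : ∀ x y, s x y * p x y < N) {γ : RN N → ℝ} (hγc : Continuous γ)
    (hγ0 : ∀ x, 0 < γ x) (hγ : ∀ x, γ x < pstar s p x) :
    ∃ C : ℝ≥0∞, C ≠ ⊤ ∧ ∀ v, UnitModular Ω s p v →
      ∫⁻ x in Ω, ENNReal.ofReal |v x| ^ γ x ≤ C := by
  suffices h : ∃ C : ℝ≥0∞, C ≠ ⊤ ∧ ∀ v, UnitModular Ω s p v →
      ∫⁻ x in closure Ω, ENNReal.ofReal |v x| ^ γ x ≤ C by
    obtain ⟨C, hC, H⟩ := h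
    exact ⟨C, hC, fun v hv => (lintegral_mono_set subset_closure).trans (H v hv)⟩
  refine hΩb.isCompact_closure.induction_on (p := fun S => ∃ C : ℝ≥0∞, C ≠ ⊤ ∧
    ∀ v, UnitModular Ω s p v → ∫⁻ x in S, ENNReal.ofReal |v x| ^ γ x ≤ C) ?_ ?_ ?_ ?_
  · exact ⟨0, ENNReal.zero_ne_top, fun v _ => by simp⟩
  · rintro S T hST ⟨C, hC, H⟩
    exact ⟨C, hC, fun v hv => (lintegral_mono_set hST).trans (H v hv)⟩
  · rintro S T ⟨C, hC, H⟩ ⟨C', hC', H'⟩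
    exact ⟨C + C', ENNReal.add_ne_top.2 ⟨hC, hC'⟩, fun v hv =>
      (lintegral_union_le _ _ _).trans (add_le_add (H v hv) (H' v hv))⟩
  · intro x₀ _
    obtain ⟨m, hm, hdec⟩ := exists_tailDecay_gt hN hΩ hΩb hsc hpc hp1 hs0 hsp x₀ (hγ x₀)
    obtain ⟨γ₁, hγ₁, hγ₁m⟩ := exists_between hm
    obtain ⟨δ, hδ, C, hC, H⟩ := hdec.exists_lintegral_le ((hγ0 x₀).trans hγ₁) hγ₁m
    obtain ⟨δ', hδ', hγδ'⟩ := Metric.eventually_nhds_iff_ball.1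
      ((hγc.tendsto x₀).eventually_lt_const hγ₁)
    set U := Metric.ball x₀ (min δ δ') with hU
    refine ⟨U, mem_nhdsWithin_of_mem_nhds (Metric.ball_mem_nhds _ (lt_min hδ hδ')),
      volume U + C, ENNReal.add_ne_top.2 ⟨measure_ball_lt_top.ne, hC⟩, fun v hv => ?_⟩
    calc ∫⁻ x in U, ENNReal.ofReal |v x| ^ γ x
        ≤ ∫⁻ x in U, (1 + ENNReal.ofReal (|v x| ^ γ₁)) := by
          refine setLIntegral_mono' measurableSet_ball fun x hx => ?_
          have hxγ : γ x < γ₁ := hγδ' x (Metric.ball_subset_ball (min_le_right _ _) hx)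
          rw [ENNReal.ofReal_rpow_of_nonneg (abs_nonneg _) (hγ0 x).le]
          rcases le_total |v x| 1 with h1 | h1
          · refine le_trans ?_ le_self_add
            rw [ENNReal.ofReal_le_one]
            exact Real.rpow_le_one (abs_nonneg _) h1 (hγ0 x).le
          · exact (ENNReal.ofReal_le_ofReal
              (Real.rpow_le_rpow_of_exponent_le h1 hxγ.le)).trans le_add_self
      _ = volume U + ∫⁻ x in U, ENNReal.ofReal (|v x| ^ γ₁) := by
          rw [lintegral_add_left measurable_const, setLIntegral_one]
      _ ≤ volume U + C := by
          refine add_le_add_right ((lintegral_mono_set ?_).trans (H v hv)) _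
          exact Metric.ball_subset_ball (min_le_left _ _)

lemma gmodular_univ_eq_Qset {Ω : Set (RN N)} {s p : RN N → RN N → ℝ} {u : RN N → ℝ}
    (hΩ : IsOpen Ω) (hp : ∀ x y, 0 < p x y) (hu : ∀ᵐ x, x ∉ Ω → u x = 0) (l : ℝ) :
    gmodular univ s p u l = gmodular (Qset Ω) s p u l := by
  have hQ : MeasurableSet (Qset Ω) :=
    MeasurableSet.univ.diff (hΩ.measurableSet.compl.prod hΩ.measurableSet.compl)
  rw [gmodular, gmodular, Measure.restrict_univ, ← lintegral_indicator hQ]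
  refine lintegral_congr_ae ?_
  have h1 : ∀ᵐ z : RN N × RN N, z.1 ∉ Ω → u z.1 = 0 := by
    rw [Measure.volume_eq_prod]
    exact Measure.quasiMeasurePreserving_fst.ae hu
  have h2 : ∀ᵐ z : RN N × RN N, z.2 ∉ Ω → u z.2 = 0 := by
    rw [Measure.volume_eq_prod]
    exact Measure.quasiMeasurePreserving_snd.ae hu
  filter_upwards [h1, h2] with z hz1 hz2
  by_cases hz : z ∈ Qset Ω
  · rw [indicator_of_mem hz]
  · rw [indicator_of_notMem hz]
    have hz' : z.1 ∉ Ω ∧ z.2 ∉ Ω := by simpa [Qset] using hz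
    rw [hz1 hz'.1, hz2 hz'.2]
    simp [ENNReal.zero_rpow_of_pos (hp _ _)]

/-- The set of admissible scalings in the definition of the `X₀`-norm is nonempty. -/
lemma exists_gmodular_lt_one_s15 {s p : RN N → RN N → ℝ} {u : RN N → ℝ}
    (hp1 : ∀ x y, 1 ≤ p x y) {l : ℝ} (hl : 0 < l) (h : gmodular univ s p u l < ⊤) :
    ∃ l', 0 < l' ∧ gmodular univ s p u l' < 1 := by
  set G := (gmodular univ s p u l).toReal with hG
  have hG0 : 0 ≤ G := ENNReal.toReal_nonneg
  set k := (G + 2)⁻¹ with hk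
  have hk0 : 0 < k := by positivity
  have hk1 : k ≤ 1 := inv_le_one_of_one_le₀ (by linarith)
  refine ⟨l / k, by positivity, ?_⟩
  have hle : gmodular univ s p u (l / k) ≤ ENNReal.ofReal k * gmodular univ s p u l := by
    rw [gmodular, gmodular, ← lintegral_const_mul' _ _ ENNReal.ofReal_ne_top]
    refine lintegral_mono fun z => ?_
    dsimp only
    rw [← mul_div_assoc]
    refine ENNReal.div_le_div_right ?_ _
    have hp0 : 0 ≤ p z.1 z.2 := zero_le_one.trans (hp1 _ _)
    rw [show |u z.1 - u z.2| / (l / k) = k * (|u z.1 - u z.2| / l) by field_simp,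
      ENNReal.ofReal_mul hk0.le, ENNReal.mul_rpow_of_nonneg _ _ hp0]
    refine mul_le_mul_left ?_ _
    rw [ENNReal.ofReal_rpow_of_nonneg hk0.le hp0]
    refine ENNReal.ofReal_le_ofReal ?_
    calc k ^ p z.1 z.2 ≤ k ^ (1 : ℝ) := Real.rpow_le_rpow_of_exponent_ge hk0 hk1 (hp1 _ _)
      _ = k := Real.rpow_one k
  refine hle.trans_lt ?_
  rw [← ENNReal.ofReal_toReal h.ne, ← hG, ← ENNReal.ofReal_mul hk0.le, ENNReal.ofReal_lt_one,
    hk, inv_mul_lt_one₀ (by positivity)]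
  linarith

lemma abs_Fant_le {f : RN N → ℝ → ℝ} {x : RN N} {M r : ℝ} (hr : 1 ≤ r) (hM : 0 ≤ M)
    (h : ∀ t, |f x t| ≤ M * |t| ^ (r - 1)) (t : ℝ) : |Fant f x t| ≤ M * |t| ^ r := by
  have h1 : ‖∫ τ in (0 : ℝ)..t, f x τ‖ ≤ M * |t| ^ (r - 1) * |t - 0| := by
    refine intervalIntegral.norm_integral_le_of_norm_le_const fun τ hτ => (h τ).trans ?_
    have : |τ| ≤ |t| := by
      rcases le_total 0 t with h0 | h0
      · rw [uIoc_of_le h0] at hτ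
        rw [abs_of_pos hτ.1, abs_of_nonneg h0]
        exact hτ.2
      · rw [uIoc_of_ge h0] at hτ
        rw [abs_of_nonpos hτ.2, abs_of_nonpos h0]
        linarith [hτ.1]
    gcongr
  rcases eq_or_ne t 0 with rfl | ht
  · rw [Fant, intervalIntegral.integral_same, abs_zero]
    positivity
  · rw [sub_zero, mul_assoc, ← Real.rpow_add_one (abs_ne_zero.2 ht), sub_add_cancel] at h1
    exact h1

/-- The Lebesgue norm estimate for a fixed subcritical exponent `Q`. -/
lemma exists_cLpNorm_Fant_le (hN : 2 ≤ N) {Ω : Set (RN N)} (hΩ : IsOpen Ω)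
    (hΩb : Bornology.IsBounded Ω) {s p : RN N → RN N → ℝ}
    (hsc : Continuous fun z : RN N × RN N => s z.1 z.2)
    (hpc : Continuous fun z : RN N × RN N => p z.1 z.2)
    (hp1 : ∀ x y, 1 ≤ p x y) (hs0 : ∀ x y, 0 < s x y)
    (hsp : ∀ x y, s x y * p x y < N) {f : RN N → ℝ → ℝ} {M : ℝ} {r : RN N → ℝ}
    (hr : CPlusOn univ r) (hf : F1 Ω f M r) {Q : ℝ} (hQ : 0 < Q)
    (hrQ : ∀ x, r x * Q < pstar s p x) :
    ∃ c : ℝ, 0 < c ∧ ∀ u : RN N → ℝ, MemX0 Ω s p (fun x => p x x) u →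
      cLpNorm Ω Q (fun x => Fant f x (u x)) ≤
        c * max (x0Norm s p u ^ supOn univ r) (x0Norm s p u ^ infOn univ r) := by
  obtain ⟨hrc, hr1, hrb⟩ := hr
  obtain ⟨hM, hf⟩ := hf
  have hrx : ∀ x, infOn univ r ≤ r x := infOn_univ_le (by linarith)
  have hrx1 : ∀ x, 1 < r x := fun x => hr1.trans_le (hrx x)
  have hrs : ∀ x, r x ≤ supOn univ r := le_supOn_univ hrb
  have hsup : 0 ≤ supOn univ r := by linarith [hrs 0, hrx1 0]
  obtain ⟨C, hC, H⟩ := exists_lintegral_rpow_le hN hΩ hΩb hsc hpc hp1 hs0 hsp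
    (γ := fun x => r x * Q) ((continuousOn_univ.1 hrc).mul continuous_const)
    (fun x => mul_pos (by linarith [hrx1 x]) hQ) hrQ
  set c := M * C.toReal ^ (1 / Q) with hc
  have hc0 : 0 ≤ c := by positivity
  refine ⟨c + 1, by positivity, fun u hu => ?_⟩
  obtain ⟨hum, -, ⟨l₀, hl₀, hl₀'⟩, huΩ⟩ := hu
  set g : ℝ → ℝ := fun l => max (l ^ supOn univ r) (l ^ infOn univ r) with hg
  have hgc : Continuous g :=
    (Real.continuous_rpow_const hsup).max (Real.continuous_rpow_const (by linarith))
  have hmain : ∀ l, 0 < l → gmodular univ s p u l < 1 →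
      cLpNorm Ω Q (fun x => Fant f x (u x)) ≤ (c + 1) * g l := by
    intro l hl hlu
    have hgl : 0 < g l := lt_max_of_lt_left (by positivity)
    have hv : UnitModular Ω s p (fun x => u x / l) := by
      refine ⟨hum.div_const l, ?_, ?_⟩
      · filter_upwards [huΩ] with x hx hxΩ
        rw [hx hxΩ, zero_div]
      · refine le_trans (le_of_eq ?_) hlu.le
        simp only [gmodular, ← sub_div, abs_div, abs_of_pos hl, div_one]
    have hint : ∫⁻ x in Ω, ENNReal.ofReal |Fant f x (u x)| ^ Q ≤
        ENNReal.ofReal (M * g l) ^ Q * C := by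
      refine le_trans ?_ (mul_le_mul_right (H _ hv) _)
      rw [← lintegral_const_mul' _ _ (ENNReal.rpow_ne_top_of_nonneg hQ.le ENNReal.ofReal_ne_top)]
      refine setLIntegral_mono' hΩ.measurableSet fun x hx => ?_
      rw [ENNReal.rpow_mul, ← ENNReal.mul_rpow_of_nonneg _ _ hQ.le,
        ENNReal.ofReal_rpow_of_nonneg (abs_nonneg (u x / l)) (by linarith [hrx1 x]),
        ← ENNReal.ofReal_mul (by positivity)]
      refine ENNReal.rpow_le_rpow (ENNReal.ofReal_le_ofReal ?_) hQ.le
      refine (abs_Fant_le (hrx1 x).le hM.le (hf x hx) (u x)).trans ?_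
      rw [mul_assoc]
      refine mul_le_mul_of_nonneg_left ?_ hM.le
      have hul : |u x| = l * |u x / l| := by
        rw [abs_div, abs_of_pos hl]
        field_simp
      have hlr : l ^ r x ≤ g l := by
        rcases le_total l 1 with h1 | h1
        · exact (Real.rpow_le_rpow_of_exponent_ge hl h1 (hrx x)).trans (le_max_right _ _)
        · exact (Real.rpow_le_rpow_of_exponent_le h1 (hrs x)).trans (le_max_left _ _)
      rw [hul, Real.mul_rpow hl.le (abs_nonneg _)]
      exact mul_le_mul_of_nonneg_right hlr (by positivity)
    have hRtop : ENNReal.ofReal (M * g l) ^ Q * C ≠ ⊤ :=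
      ENNReal.mul_ne_top (ENNReal.rpow_ne_top_of_nonneg hQ.le ENNReal.ofReal_ne_top) hC
    calc cLpNorm Ω Q (fun x => Fant f x (u x))
        ≤ (ENNReal.ofReal (M * g l) ^ Q * C).toReal ^ (1 / Q) :=
          Real.rpow_le_rpow ENNReal.toReal_nonneg (ENNReal.toReal_mono hRtop hint) (by positivity)
      _ = c * g l := by
          rw [ENNReal.toReal_mul, ← ENNReal.toReal_rpow, ENNReal.toReal_ofReal (by positivity),
            Real.mul_rpow (by positivity) ENNReal.toReal_nonneg,
            ← Real.rpow_mul (by positivity), mul_one_div_cancel hQ.ne', Real.rpow_one, hc]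
          ring
      _ ≤ (c + 1) * g l := by linarith
  have hne : {l | 0 < l ∧ gmodular univ s p u l < 1}.Nonempty := by
    rw [← gmodular_univ_eq_Qset hΩ (fun x y => one_pos.trans_le (hp1 x y)) huΩ] at hl₀'
    exact exists_gmodular_lt_one_s15 hp1 hl₀ hl₀'
  have hmem : x0Norm s p u ∈ closure {l | 0 < l ∧ gmodular univ s p u l < 1} :=
    csInf_mem_closure hne ⟨0, fun l hl => hl.1.le⟩
  have hclosed : IsClosed {l | cLpNorm Ω Q (fun x => Fant f x (u x)) ≤ (c + 1) * g l} :=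
    isClosed_le continuous_const (continuous_const.mul hgc)
  exact closure_minimal (fun l hl => hmain l hl.1 hl.2) hclosed hmem

/-- Estimate of the `L^{q⁺}`/`L^{q⁻}` norms of `F(·,u(·))` (estimate (4.2)). -/
theorem statement15 {N : ℕ} (hN : 2 ≤ N) (Ω : Set (RN N))
    (hΩo : IsOpen Ω) (hΩb : Bornology.IsBounded Ω) (hΩne : Ω.Nonempty)
    (s p μ q : RN N → RN N → ℝ) (f : RN N → ℝ → ℝ) (M : ℝ) (r : RN N → ℝ)
    (hs : S1 s) (hp : P1 s p) (hμ : Mu1 μ) (hq : CPlus2 q)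
    (hqμ : ∀ x y, 2 / q x y + μ x y / (N : ℝ) = 2)
    (hf : Caratheodory f)
    (hr : CPlusOn univ r) (hrM : MemM s p q r) (hrp : sup2 p < infOn univ r)
    (hf1 : F1 Ω f M r) :
    ∃ c : ℝ, 0 < c ∧ ∀ u : RN N → ℝ, MemX0 Ω s p (fun x => p x x) u →
      cLpNorm Ω (sup2 q) (fun x => Fant f x (u x)) ≤
        c * max (x0Norm s p u ^ supOn univ r) (x0Norm s p u ^ infOn univ r) ∧
      cLpNorm Ω (inf2 q) (fun x => Fant f x (u x)) ≤
        c * max (x0Norm s p u ^ supOn univ r) (x0Norm s p u ^ infOn univ r) := by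
  obtain ⟨hsc, -, hsb, hs0, -⟩ := hs
  obtain ⟨⟨hpc, hp1, hpb⟩, -, hspN⟩ := hp
  obtain ⟨-, hq1, hqb⟩ := hq
  have hp1' : ∀ x y, 1 ≤ p x y := fun x y => hp1.le.trans (inf2_le (by linarith) x y)
  have hs0' : ∀ x y, 0 < s x y := fun x y => hs0.trans_le (inf2_le hs0 x y)
  have hsp : ∀ x y, s x y * p x y < N := fun x y =>
    (mul_le_mul (le_sup2 hsb x y) (le_sup2 hpb x y) (zero_le_one.trans (hp1' x y))
      ((hs0' x y).le.trans (le_sup2 hsb x y))).trans_lt hspN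
  have hqq : inf2 q ≤ sup2 q := (inf2_le (by linarith) 0 0).trans (le_sup2 hqb 0 0)
  obtain ⟨c₁, hc₁, H₁⟩ := exists_cLpNorm_Fant_le hN hΩo hΩb hsc hpc hp1' hs0' hsp hr hf1
    (Q := sup2 q) (by linarith) fun x => (hrM x).2.2
  obtain ⟨c₂, hc₂, H₂⟩ := exists_cLpNorm_Fant_le hN hΩo hΩb hsc hpc hp1' hs0' hsp hr hf1
    (Q := inf2 q) (by linarith) fun x => (hrM x).2.1.trans_lt (hrM x).2.2
  have hx0 : ∀ u, 0 ≤ x0Norm s p u := fun u => Real.sInf_nonneg fun l hl => hl.1.le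
  refine ⟨max c₁ c₂, lt_max_of_lt_left hc₁, fun u hu => ⟨(H₁ u hu).trans ?_, (H₂ u hu).trans ?_⟩⟩
  · exact mul_le_mul_of_nonneg_right (le_max_left _ _)
      (le_max_of_le_left (Real.rpow_nonneg (hx0 u) _))
  · exact mul_le_mul_of_nonneg_right (le_max_right _ _)
      (le_max_of_le_left (Real.rpow_nonneg (hx0 u) _))

end VarOrderChoquard
end
end
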